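/- The Kendall's tau of the copula C(u,v) = uv[1 - r(1-u^{1/λ₁})(1-v^{1/λ₂})]^{-λ}, with λ₁ ≥ λ > 0, λ₂ ≥ λ, 0 ≤ r < 1, equals τ = 1 - ₃F₂(2λ,1,1; 2λ₁+1, 2λ₂+1; r) + [4λ r/((2λ₁+1)(2λ₂+1))]·₃F₂(2λ+1,1,2; 2λ₁+2, 2λ₂+2; r) - [λ² r²/((2λ₁+1)(2λ₂+1)(λ₁+1)(λ₂+1))]·₃F₂(2λ+2,2,2; 2λ₁+3, 2λ₂+3; r). -/

import Mathlib

open MeasureTheory Real Set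

noncomputable def poch (a : ℝ) (n : ℕ) : ℝ := (ascPochhammer ℝ n).eval a

/-- The generalized hypergeometric function `₃F₂(a₁,a₂,a₃;b₁,b₂;z)`. -/
noncomputable def F32 (a₁ a₂ a₃ b₁ b₂ z : ℝ) : ℝ :=
  ∑' k : ℕ, (poch a₁ k * poch a₂ k * poch a₃ k) / (poch b₁ k * poch b₂ k) *
    z ^ k / k.factorial

theorem poch_succ_right (x : ℝ) (n : ℕ) : poch x (n + 1) = poch x n * (x + n) :=
  ascPochhammer_succ_eval n x

theorem poch_succ_left (x : ℝ) (n : ℕ) : poch x (n + 1) = x * poch (x + 1) n := by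
  simp [poch, ascPochhammer_succ_left, Polynomial.eval_comp]

theorem poch_add_two (x : ℝ) (n : ℕ) : poch x (n + 2) = x * (x + 1) * poch (x + 2) n := by
  rw [poch_succ_left, poch_succ_left, add_assoc, one_add_one_eq_two, mul_assoc]

theorem poch_pos {x : ℝ} (hx : 0 < x) (n : ℕ) : 0 < poch x n :=
  ascPochhammer_pos n x hx

theorem poch_one (n : ℕ) : poch 1 n = n.factorial :=
  ascPochhammer_eval_one ℝ n

theorem poch_two (n : ℕ) : poch 2 n = (n + 1).factorial := by
  rw [← poch_one, poch_succ_left, one_mul, one_add_one_eq_two]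

/-- The binomial series of `(1 - x) ^ (-α)`. -/
theorem hasSum_one_sub_rpow_neg (α : ℝ) {x : ℝ} (hx : |x| < 1) :
    HasSum (fun k : ℕ => poch α k / k.factorial * x ^ k) ((1 - x) ^ (-α)) := by
  have h := (Real.one_div_one_sub_rpow_hasFPowerSeriesOnBall_zero α).hasSum (y := x)
    (by simpa [enorm_eq_nnnorm, ← NNReal.coe_lt_coe] using hx)
  have hpos : 0 ≤ 1 - x := by linarith [(abs_lt.mp hx).2]
  rw [zero_add, one_div, ← Real.rpow_neg hpos] at h
  refine h.congr_fun fun k => ?_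
  have hk := Ring.factorial_nsmul_multichoose_eq_ascPochhammer α k
  rw [Polynomial.ascPochhammer_smeval_eq_eval, nsmul_eq_mul] at hk
  have hk0 : (k.factorial : ℝ) ≠ 0 := by positivity
  rw [poch, ← hk, Ring.multichoose_eq]
  simp [FormalMultilinearSeries.ofScalars, mul_div_cancel_left₀ _ hk0]

/-- A beta-type integral, by induction on the integer exponent. -/
theorem integral_rpow_mul_one_sub_rpow_pow {a : ℝ} (ha : 0 < a) (n : ℕ) {c : ℝ} (hc : 0 ≤ c) :
    ∫ u in (0:ℝ)..1, u ^ c * (1 - u ^ a) ^ n =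
      n.factorial / (a * poch ((c + 1) / a) (n + 1)) := by
  induction n generalizing c with
  | zero =>
    have : a * poch ((c + 1) / a) (0 + 1) = c + 1 := by
      simp [poch]; field_simp
    rw [this]
    simp [integral_rpow (Or.inl (by linarith : -1 < c))]
    rw [Real.zero_rpow (by positivity)]
    simp
  | succ n ih =>
    have hint : ∀ d : ℝ, 0 ≤ d →
        IntervalIntegrable (fun u : ℝ => u ^ d * (1 - u ^ a) ^ n) volume 0 1 := fun d hd =>
      ((Real.continuous_rpow_const hd).mul
        ((continuous_const.sub (Real.continuous_rpow_const ha.le)).pow n)).intervalIntegrable _ _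
    have hsplit : ∫ u in (0:ℝ)..1, u ^ c * (1 - u ^ a) ^ (n + 1) =
        ∫ u in (0:ℝ)..1, (u ^ c * (1 - u ^ a) ^ n - u ^ (c + a) * (1 - u ^ a) ^ n) := by
      refine intervalIntegral.integral_congr_ae (.of_forall fun u hu => ?_)
      rw [uIoc_of_le zero_le_one] at hu
      rw [Real.rpow_add hu.1]
      ring
    rw [hsplit, intervalIntegral.integral_sub (hint c hc) (hint _ (by positivity)), ih hc,
      ih (by positivity)]
    have hx : (c + a + 1) / a = (c + 1) / a + 1 := by field_simp; ring
    have hx0 : 0 < (c + 1) / a := by positivity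
    rw [hx]
    generalize (c + 1) / a = x at hx0
    have h1 := poch_pos (by positivity : 0 < x + 1) n
    rw [poch_succ_left x (n + 1), poch_succ_left x n, poch_succ_right (x + 1) n, Nat.factorial_succ]
    have h2 : 0 < x + 1 + n := by positivity
    push_cast
    field_simp
    ring

/-- Termwise integration over the unit square of the binomial series of a product kernel. -/
theorem integrable_and_hasSum_integral_prod {α r : ℝ} (hα : 0 < α) (hr0 : 0 ≤ r) (hr1 : r < 1)
    {g h p q : ℝ → ℝ} (hg : Continuous g) (hh : Continuous h) (hp : Continuous p)
    (hq : Continuous q) (hp01 : ∀ u ∈ Icc (0:ℝ) 1, p u ∈ Icc (0:ℝ) 1)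
    (hq01 : ∀ u ∈ Icc (0:ℝ) 1, q u ∈ Icc (0:ℝ) 1) :
    Integrable (fun z : ℝ × ℝ => g z.1 * h z.2 * (1 - r * p z.1 * q z.2) ^ (-α))
      ((volume.restrict (Ioc 0 1)).prod (volume.restrict (Ioc 0 1))) ∧
    HasSum (fun k : ℕ => poch α k / k.factorial * r ^ k *
        ((∫ u in (0:ℝ)..1, g u * p u ^ k) * ∫ v in (0:ℝ)..1, h v * q v ^ k))
      (∫ z, g z.1 * h z.2 * (1 - r * p z.1 * q z.2) ^ (-α)
        ∂(volume.restrict (Ioc (0:ℝ) 1)).prod (volume.restrict (Ioc (0:ℝ) 1))) := by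
  have hμ := Measure.prod_restrict (μ := (volume : Measure ℝ)) (ν := (volume : Measure ℝ))
    (Ioc (0:ℝ) 1) (Ioc (0:ℝ) 1)
  have hsub : Ioc (0:ℝ) 1 ×ˢ Ioc (0:ℝ) 1 ⊆ Icc (0:ℝ) 1 ×ˢ Icc (0:ℝ) 1 :=
    prod_mono Ioc_subset_Icc_self Ioc_subset_Icc_self
  have hpq : ∀ z ∈ Icc (0:ℝ) 1 ×ˢ Icc (0:ℝ) 1, 0 ≤ p z.1 * q z.2 ∧ p z.1 * q z.2 ≤ 1 :=
    fun z hz => ⟨mul_nonneg (hp01 _ hz.1).1 (hq01 _ hz.2).1,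
      mul_le_one₀ (hp01 _ hz.1).2 (hq01 _ hz.2).1 (hq01 _ hz.2).2⟩
  have hint : ∀ f : ℝ × ℝ → ℝ, ContinuousOn f (Icc (0:ℝ) 1 ×ˢ Icc (0:ℝ) 1) →
      Integrable f ((volume.restrict (Ioc 0 1)).prod (volume.restrict (Ioc 0 1))) := by
    intro f hf
    rw [hμ]
    exact (hf.integrableOn_compact (isCompact_Icc.prod isCompact_Icc)).mono_set hsub
  have hae : ∀ᵐ z ∂(volume.restrict (Ioc (0:ℝ) 1)).prod (volume.restrict (Ioc (0:ℝ) 1)),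
      z ∈ Icc (0:ℝ) 1 ×ˢ Icc (0:ℝ) 1 := by
    rw [hμ]
    exact (ae_restrict_mem (measurableSet_Ioc.prod measurableSet_Ioc)).mono fun z hz => hsub hz
  have hc : ∀ k : ℕ, 0 ≤ poch α k / k.factorial * r ^ k := fun k => by
    have := poch_pos hα k
    positivity
  refine ⟨hint _ ?_, ?_⟩
  · refine ContinuousOn.mul (by fun_prop) (ContinuousOn.rpow_const (by fun_prop) fun z hz => ?_)
    left
    nlinarith [hpq z hz]
  have hsum : Summable fun k : ℕ => poch α k / k.factorial * r ^ k :=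
    (hasSum_one_sub_rpow_neg α (abs_lt.mpr ⟨by linarith, hr1⟩)).summable
  have key := hasSum_integral_of_dominated_convergence
    (μ := (volume.restrict (Ioc (0:ℝ) 1)).prod (volume.restrict (Ioc (0:ℝ) 1)))
    (F := fun (k : ℕ) (z : ℝ × ℝ) => poch α k / k.factorial * r ^ k *
      ((g z.1 * p z.1 ^ k) * (h z.2 * q z.2 ^ k)))
    (f := fun z => g z.1 * h z.2 * (1 - r * p z.1 * q z.2) ^ (-α))
    (fun k z => |g z.1 * h z.2| * (poch α k / k.factorial * r ^ k))
    (fun k => (hint _ (by fun_prop)).aestronglyMeasurable)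
    (fun k => hae.mono fun z hz => ?_)
    (.of_forall fun z => hsum.mul_left _)
    ?_
    (hae.mono fun z hz => ?_)
  · refine key.congr_fun fun k => ?_
    rw [integral_const_mul, integral_prod_mul (fun u => g u * p u ^ k) (fun v => h v * q v ^ k),
      intervalIntegral.integral_of_le zero_le_one, intervalIntegral.integral_of_le zero_le_one]
  · have h1 : (p z.1 * q z.2) ^ k ≤ 1 := pow_le_one₀ (hpq z hz).1 (hpq z hz).2
    rw [Real.norm_eq_abs, abs_mul, abs_of_nonneg (hc k), mul_comm]
    refine mul_le_mul_of_nonneg_right ?_ (hc k)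
    rw [show g z.1 * p z.1 ^ k * (h z.2 * q z.2 ^ k) = g z.1 * h z.2 * (p z.1 * q z.2) ^ k by ring,
      abs_mul, abs_of_nonneg (pow_nonneg (hpq z hz).1 k)]
    exact mul_le_of_le_one_right (abs_nonneg _) h1
  · simp_rw [tsum_mul_left]
    exact hint _ (by fun_prop)
  · have hx : |r * p z.1 * q z.2| < 1 := by
      rw [mul_assoc, abs_of_nonneg (mul_nonneg hr0 (hpq z hz).1)]
      nlinarith [hpq z hz]
    refine ((hasSum_one_sub_rpow_neg α hx).mul_left (g z.1 * h z.2)).congr_fun fun k => ?_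
    ring

/-- The derivative of `x ↦ x w (1 - r (1 - x ^ a) q) ^ (-lam)`. -/
theorem deriv_mul_mul_one_sub_rpow {lam r a q w u : ℝ} (hu : 0 < u)
    (hD : 0 < 1 - r * (1 - u ^ a) * q) :
    deriv (fun x : ℝ => x * w * (1 - r * (1 - x ^ a) * q) ^ (-lam)) u =
      w * ((1 - r * (1 - u ^ a) * q) ^ (-lam) -
        lam * r * a * u ^ a * q * (1 - r * (1 - u ^ a) * q) ^ (-lam - 1)) := by
  have h1 : HasDerivAt (fun x : ℝ => x ^ a) (a * u ^ (a - 1)) u :=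
    Real.hasDerivAt_rpow_const (Or.inl hu.ne')
  have h2 : HasDerivAt (fun x : ℝ => 1 - r * (1 - x ^ a) * q) (r * (a * u ^ (a - 1)) * q) u := by
    convert! (((h1.const_sub 1).const_mul r).mul_const q).const_sub 1 using 1
    ring
  have h3 := ((hasDerivAt_id u).mul_const w).mul (h2.rpow_const (p := -lam) (Or.inl hD.ne'))
  refine HasDerivAt.deriv (h3.congr_deriv ?_)
  rw [Real.rpow_sub_one hu.ne']
  simp only [id]
  field_simp
  ring

/-- The integrand `u v s ^ m₁ (1 - s) ^ n₁ t ^ m₂ (1 - t) ^ n₂ (1 - r (1 - s) (1 - t)) ^ (-α)`,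
where `s = u ^ (1 / lam₁)` and `t = v ^ (1 / lam₂)`. -/
noncomputable def kernel (lam₁ lam₂ r α : ℝ) (m₁ n₁ m₂ n₂ : ℕ) (z : ℝ × ℝ) : ℝ :=
  z.1 ^ (1 + m₁ * (1 / lam₁)) * (1 - z.1 ^ (1 / lam₁)) ^ n₁ *
    (z.2 ^ (1 + m₂ * (1 / lam₂)) * (1 - z.2 ^ (1 / lam₂)) ^ n₂) *
    (1 - r * (1 - z.1 ^ (1 / lam₁)) * (1 - z.2 ^ (1 / lam₂))) ^ (-α)

/-- Lebesgue measure on the unit square. -/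
noncomputable abbrev squareMeasure : Measure (ℝ × ℝ) :=
  (volume.restrict (Ioc 0 1)).prod (volume.restrict (Ioc 0 1))

/-- Each `kernel` is integrable, and its integral over the unit square expands in powers of `r`. -/
theorem integrable_and_hasSum_kernel {α r lam₁ lam₂ : ℝ} (hα : 0 < α) (hr0 : 0 ≤ r) (hr1 : r < 1)
    (h₁ : 0 < lam₁) (h₂ : 0 < lam₂) (m₁ n₁ m₂ n₂ : ℕ) :
    Integrable (kernel lam₁ lam₂ r α m₁ n₁ m₂ n₂) squareMeasure ∧
    HasSum (fun k : ℕ => poch α k / k.factorial * r ^ k *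
        ((lam₁ * (n₁ + k).factorial / poch (2 * lam₁ + m₁) (n₁ + k + 1)) *
          (lam₂ * (n₂ + k).factorial / poch (2 * lam₂ + m₂) (n₂ + k + 1))))
      (∫ z, kernel lam₁ lam₂ r α m₁ n₁ m₂ n₂ z ∂squareMeasure) := by
  have hcont : ∀ {l : ℝ}, 0 < l → Continuous fun u : ℝ => 1 - u ^ (1 / l) := fun hl =>
    continuous_const.sub (Real.continuous_rpow_const (by positivity))
  have hcont' : ∀ {l : ℝ} (m n : ℕ), 0 < l →
      Continuous fun u : ℝ => u ^ (1 + m * (1 / l)) * (1 - u ^ (1 / l)) ^ n := fun m n hl =>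
    (Real.continuous_rpow_const (by positivity)).mul ((hcont hl).pow n)
  have hmem : ∀ {l : ℝ}, 0 < l → ∀ u ∈ Icc (0:ℝ) 1, 1 - u ^ (1 / l) ∈ Icc (0:ℝ) 1 :=
    fun {l} hl u hu =>
      have h0 := Real.rpow_nonneg hu.1 (1 / l)
      have h1 := Real.rpow_le_one hu.1 hu.2 (one_div_pos.mpr hl).le
      ⟨by linarith, by linarith⟩
  have hmoment : ∀ {l : ℝ} (m n k : ℕ), 0 < l →
      ∫ u in (0:ℝ)..1, u ^ (1 + m * (1 / l)) * (1 - u ^ (1 / l)) ^ n * (1 - u ^ (1 / l)) ^ k =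
        l * (n + k).factorial / poch (2 * l + m) (n + k + 1) := fun {l} m n k hl => by
    simp only [mul_assoc (_ ^ (1 + m * (1 / l)) : ℝ), ← pow_add]
    rw [integral_rpow_mul_one_sub_rpow_pow (by positivity) _ (by positivity),
      show (1 + m * (1 / l) + 1) / (1 / l) = 2 * l + m by field_simp; ring]
    have := poch_pos (by positivity : 0 < 2 * l + m) (n + k + 1)
    field_simp
  obtain ⟨hi, hs⟩ := integrable_and_hasSum_integral_prod hα hr0 hr1 (hcont' m₁ n₁ h₁)
    (hcont' m₂ n₂ h₂) (hcont h₁) (hcont h₂) (hmem h₁) (hmem h₂)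
  refine ⟨hi, hs.congr_fun fun k => ?_⟩
  rw [hmoment _ _ _ h₁, hmoment _ _ _ h₂]

theorem F32_eq_integral_kernel_zero {lam lam₁ lam₂ r : ℝ} (hlam : 0 < lam)
    (hr0 : 0 ≤ r) (hr1 : r < 1) (h₁ : 0 < lam₁) (h₂ : 0 < lam₂) :
    F32 (2 * lam) 1 1 (2 * lam₁ + 1) (2 * lam₂ + 1) r =
      4 *
        ∫ z, kernel lam₁ lam₂ r (2 * lam) 0 0 0 0 z ∂squareMeasure := by
  rw [← (integrable_and_hasSum_kernel (by positivity) hr0 hr1 h₁ h₂ 0 0 0 0).2.tsum_eq,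
    ← tsum_mul_left, F32]
  refine tsum_congr fun k => ?_
  have p₁ := poch_pos (by positivity : 0 < 2 * lam₁ + 1) k
  have p₂ := poch_pos (by positivity : 0 < 2 * lam₂ + 1) k
  have hk : (k.factorial : ℝ) ≠ 0 := by positivity
  simp only [Nat.cast_zero, add_zero, zero_add, poch_succ_left, poch_one]
  field_simp
  ring

theorem F32_eq_integral_kernel_left {lam lam₁ lam₂ r : ℝ} (hlam : 0 < lam)
    (hr0 : 0 ≤ r) (hr1 : r < 1) (h₁ : 0 < lam₁) (h₂ : 0 < lam₂) :
    F32 (2 * lam + 1) 1 2 (2 * lam₁ + 2) (2 * lam₂ + 2) r =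
      2 * (2 * lam₁ + 1) * (2 * lam₂ + 1) / lam₁ *
        ∫ z, kernel lam₁ lam₂ r (2 * lam + 1) 1 0 0 1 z ∂squareMeasure := by
  rw [← (integrable_and_hasSum_kernel (by positivity) hr0 hr1 h₁ h₂ 1 0 0 1).2.tsum_eq,
    ← tsum_mul_left, F32]
  refine tsum_congr fun k => ?_
  have p₁ := poch_pos (by positivity : 0 < 2 * lam₁ + 2) k
  have p₂ := poch_pos (by positivity : 0 < 2 * lam₂ + 2) k
  have hk : (k.factorial : ℝ) ≠ 0 := by positivity
  simp only [Nat.cast_zero, Nat.cast_one, add_zero, zero_add, add_comm 1 k, add_assoc,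
    one_add_one_eq_two, poch_add_two, poch_succ_left _ k, poch_one, poch_two]
  generalize poch (2 * lam₁ + 2) k = P₁ at p₁ ⊢
  generalize poch (2 * lam₂ + 2) k = P₂ at p₂ ⊢
  field_simp

theorem F32_eq_integral_kernel_right {lam lam₁ lam₂ r : ℝ} (hlam : 0 < lam)
    (hr0 : 0 ≤ r) (hr1 : r < 1) (h₁ : 0 < lam₁) (h₂ : 0 < lam₂) :
    F32 (2 * lam + 1) 1 2 (2 * lam₁ + 2) (2 * lam₂ + 2) r =
      2 * (2 * lam₁ + 1) * (2 * lam₂ + 1) / lam₂ *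
        ∫ z, kernel lam₁ lam₂ r (2 * lam + 1) 0 1 1 0 z ∂squareMeasure := by
  rw [← (integrable_and_hasSum_kernel (by positivity) hr0 hr1 h₁ h₂ 0 1 1 0).2.tsum_eq,
    ← tsum_mul_left, F32]
  refine tsum_congr fun k => ?_
  have p₁ := poch_pos (by positivity : 0 < 2 * lam₁ + 2) k
  have p₂ := poch_pos (by positivity : 0 < 2 * lam₂ + 2) k
  have hk : (k.factorial : ℝ) ≠ 0 := by positivity
  simp only [Nat.cast_zero, Nat.cast_one, add_zero, zero_add, add_comm 1 k, add_assoc,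
    one_add_one_eq_two, poch_add_two, poch_succ_left _ k, poch_one, poch_two]
  generalize poch (2 * lam₁ + 2) k = P₁ at p₁ ⊢
  generalize poch (2 * lam₂ + 2) k = P₂ at p₂ ⊢
  field_simp

theorem F32_eq_integral_kernel_both {lam lam₁ lam₂ r : ℝ} (hlam : 0 < lam)
    (hr0 : 0 ≤ r) (hr1 : r < 1) (h₁ : 0 < lam₁) (h₂ : 0 < lam₂) :
    F32 (2 * lam + 2) 2 2 (2 * lam₁ + 3) (2 * lam₂ + 3) r =
      (2 * lam₁ + 1) * (2 * lam₁ + 2) * (2 * lam₂ + 1) * (2 * lam₂ + 2) / (lam₁ * lam₂) *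
        ∫ z, kernel lam₁ lam₂ r (2 * lam + 2) 1 1 1 1 z ∂squareMeasure := by
  rw [← (integrable_and_hasSum_kernel (by positivity) hr0 hr1 h₁ h₂ 1 1 1 1).2.tsum_eq,
    ← tsum_mul_left, F32]
  refine tsum_congr fun k => ?_
  have p₁ := poch_pos (by positivity : 0 < 2 * lam₁ + 3) k
  have p₂ := poch_pos (by positivity : 0 < 2 * lam₂ + 3) k
  have hk : (k.factorial : ℝ) ≠ 0 := by positivity
  simp only [Nat.cast_one, add_comm 1 k, poch_two, add_assoc, one_add_one_eq_two, poch_add_two,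
    (by norm_num : (1:ℝ) + 2 = 3)]
  generalize poch (2 * lam₁ + 3) k = P₁ at p₁ ⊢
  generalize poch (2 * lam₂ + 3) k = P₂ at p₂ ⊢
  field_simp

/-- The double integral in Kendall's tau, expanded along the product rule. -/
theorem integral_deriv_mul_deriv_eq {lam lam₁ lam₂ r : ℝ} (hlam : 0 < lam)
    (hr0 : 0 ≤ r) (hr1 : r < 1) (h₁ : 0 < lam₁) (h₂ : 0 < lam₂)
    {C : ℝ → ℝ → ℝ} (hC : ∀ u v : ℝ, C u v =
      u * v * (1 - r * (1 - u ^ (1 / lam₁)) * (1 - v ^ (1 / lam₂))) ^ (-lam)) :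
    ∫ u in (0:ℝ)..1, ∫ v in (0:ℝ)..1, deriv (fun x => C x v) u * deriv (fun y => C u y) v =
      (∫ z, kernel lam₁ lam₂ r (2 * lam) 0 0 0 0 z ∂squareMeasure) -
        lam * r / lam₁ * (∫ z, kernel lam₁ lam₂ r (2 * lam + 1) 1 0 0 1 z ∂squareMeasure) -
        lam * r / lam₂ * (∫ z, kernel lam₁ lam₂ r (2 * lam + 1) 0 1 1 0 z ∂squareMeasure) +
        lam ^ 2 * r ^ 2 / (lam₁ * lam₂) *
          ∫ z, kernel lam₁ lam₂ r (2 * lam + 2) 1 1 1 1 z ∂squareMeasure := by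
  have i₀ := (integrable_and_hasSum_kernel (by positivity : 0 < 2 * lam) hr0 hr1 h₁ h₂ 0 0 0 0).1
  have i₁ := (integrable_and_hasSum_kernel (by positivity : 0 < 2 * lam + 1) hr0 hr1 h₁ h₂
    1 0 0 1).1
  have i₂ := (integrable_and_hasSum_kernel (by positivity : 0 < 2 * lam + 1) hr0 hr1 h₁ h₂
    0 1 1 0).1
  have i₃ := (integrable_and_hasSum_kernel (by positivity : 0 < 2 * lam + 2) hr0 hr1 h₁ h₂
    1 1 1 1).1
  have j₁ := i₁.const_mul (lam * r / lam₁)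
  have j₂ := i₂.const_mul (lam * r / lam₂)
  have j₃ := i₃.const_mul (lam ^ 2 * r ^ 2 / (lam₁ * lam₂))
  have j₀₁ : Integrable (fun z => kernel lam₁ lam₂ r (2 * lam) 0 0 0 0 z -
      lam * r / lam₁ * kernel lam₁ lam₂ r (2 * lam + 1) 1 0 0 1 z) squareMeasure := i₀.sub j₁
  have j₀₂ : Integrable (fun z => kernel lam₁ lam₂ r (2 * lam) 0 0 0 0 z -
      lam * r / lam₁ * kernel lam₁ lam₂ r (2 * lam + 1) 1 0 0 1 z -
      lam * r / lam₂ * kernel lam₁ lam₂ r (2 * lam + 1) 0 1 1 0 z) squareMeasure := j₀₁.sub j₂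
  rw [← integral_const_mul, ← integral_const_mul, ← integral_const_mul, ← integral_sub i₀ j₁,
    ← integral_sub j₀₁ j₂, ← integral_add j₀₂ j₃,
    intervalIntegral.integral_of_le zero_le_one]
  refine Eq.trans ?_ (integral_prod _ (j₀₂.add j₃)).symm
  refine setIntegral_congr_fun measurableSet_Ioc fun u hu => ?_
  simp only [Pi.add_apply]
  rw [intervalIntegral.integral_of_le zero_le_one]
  refine setIntegral_congr_fun measurableSet_Ioc fun v hv => ?_
  have hs0 := Real.rpow_pos_of_pos hu.1 (1 / lam₁)
  have ht0 := Real.rpow_pos_of_pos hv.1 (1 / lam₂)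
  have hs1 := Real.rpow_le_one hu.1.le hu.2 (one_div_pos.mpr h₁).le
  have ht1 := Real.rpow_le_one hv.1.le hv.2 (one_div_pos.mpr h₂).le
  have hD : 0 < 1 - r * (1 - u ^ (1 / lam₁)) * (1 - v ^ (1 / lam₂)) := by
    have : (1 - u ^ (1 / lam₁)) * (1 - v ^ (1 / lam₂)) ≤ 1 :=
      mul_le_one₀ (by linarith) (by linarith) (by linarith)
    nlinarith
  have hD' : 0 < 1 - r * (1 - v ^ (1 / lam₂)) * (1 - u ^ (1 / lam₁)) := by
    rwa [mul_right_comm] at hD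
  have du := deriv_mul_mul_one_sub_rpow (lam := lam) (w := v) hu.1 hD
  have dv := deriv_mul_mul_one_sub_rpow (lam := lam) (w := u) hv.1 hD'
  have hu' : (fun x => C x v) = fun x : ℝ =>
      x * v * (1 - r * (1 - x ^ (1 / lam₁)) * (1 - v ^ (1 / lam₂))) ^ (-lam) :=
    funext fun x => hC x v
  have hv' : (fun y => C u y) = fun y : ℝ =>
      y * u * (1 - r * (1 - y ^ (1 / lam₂)) * (1 - u ^ (1 / lam₁))) ^ (-lam) :=
    funext fun y => by rw [hC, mul_right_comm r, mul_comm u]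
  simp only [hu', hv', du, dv]
  rw [mul_right_comm r (1 - v ^ (1 / lam₂))]
  simp only [kernel, Nat.cast_zero, Nat.cast_one, zero_mul, one_mul, add_zero, pow_zero, pow_one,
    Real.rpow_one, mul_one, Real.rpow_add hu.1, Real.rpow_add hv.1]
  generalize 1 - r * (1 - u ^ (1 / lam₁)) * (1 - v ^ (1 / lam₂)) = D at hD
  rw [show -(2 * lam) = -lam + -lam by ring, show -(2 * lam + 1) = -lam + -lam - 1 by ring,
    show -(2 * lam + 2) = -lam + -lam - 1 - 1 by ring]
  simp only [Real.rpow_sub_one hD.ne', Real.rpow_add hD]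
  field_simp
  ring

theorem kendall_tau_of_copula (lam lam₁ lam₂ r : ℝ)
    (hlam : 0 < lam) (hlam₁ : lam ≤ lam₁) (hlam₂ : lam ≤ lam₂)
    (hr0 : 0 ≤ r) (hr1 : r < 1)
    (C : ℝ → ℝ → ℝ)
    (hC : ∀ u v : ℝ, C u v =
      u * v * (1 - r * (1 - u ^ (1 / lam₁)) * (1 - v ^ (1 / lam₂))) ^ (-lam)) :
    1 - 4 * ∫ u in (0:ℝ)..1, ∫ v in (0:ℝ)..1,
        deriv (fun x => C x v) u * deriv (fun y => C u y) v =
      1 - F32 (2 * lam) 1 1 (2 * lam₁ + 1) (2 * lam₂ + 1) r +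
        4 * lam * r / ((2 * lam₁ + 1) * (2 * lam₂ + 1)) *
          F32 (2 * lam + 1) 1 2 (2 * lam₁ + 2) (2 * lam₂ + 2) r -
        lam ^ 2 * r ^ 2 / ((2 * lam₁ + 1) * (2 * lam₂ + 1) * (lam₁ + 1) * (lam₂ + 1)) *
          F32 (2 * lam + 2) 2 2 (2 * lam₁ + 3) (2 * lam₂ + 3) r := by
  have h₁ : 0 < lam₁ := hlam.trans_le hlam₁
  have h₂ : 0 < lam₂ := hlam.trans_le hlam₂
  have e₁ := F32_eq_integral_kernel_left hlam hr0 hr1 h₁ h₂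
  have e₂ := F32_eq_integral_kernel_right hlam hr0 hr1 h₁ h₂
  rw [integral_deriv_mul_deriv_eq hlam hr0 hr1 h₁ h₂ hC,
    F32_eq_integral_kernel_zero hlam hr0 hr1 h₁ h₂, F32_eq_integral_kernel_both hlam hr0 hr1 h₁ h₂]
  generalize F32 (2 * lam + 1) 1 2 (2 * lam₁ + 2) (2 * lam₂ + 2) r = F at e₁ e₂ ⊢
  have f₁ : lam * r / lam₁ * (∫ z, kernel lam₁ lam₂ r (2 * lam + 1) 1 0 0 1 z ∂squareMeasure) =
      lam * r / (2 * (2 * lam₁ + 1) * (2 * lam₂ + 1)) * F := by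
    rw [e₁]
    field_simp
  have f₂ : lam * r / lam₂ * (∫ z, kernel lam₁ lam₂ r (2 * lam + 1) 0 1 1 0 z ∂squareMeasure) =
      lam * r / (2 * (2 * lam₁ + 1) * (2 * lam₂ + 1)) * F := by
    rw [e₂]
    field_simp
  rw [f₁, f₂]
  field_simp
  ring
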